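/- Let 𝒫 be a graded poset for which there exists an adequate local covering family, with associated functors F_0 = c_ℤ, F_1, F_2, …. Then the sequence 0 → ∏_{p ∈ Ob_0(𝒫)} F_0(p) → ∏_{p ∈ Ob_1(𝒫)} F_1(p) → ∏_{p ∈ Ob_2(𝒫)} F_2(p) → …, with differentials d_n = ι_{n+1} ∘ ω_{n+1}, is a co-chain complex whose cohomology is H^*(𝒫; ℤ). -/

import Mathlib

open Finset

/-- A graded poset (with the standing assumptions of Remark 2.5: the degree function is
order-reversing, adds one along preceding pairs, takes nonnegative values, and every
up-set is finite). -/
structure GradedPoset (P : Type) [PartialOrder P] : Type where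
  deg : P → ℤ
  deg_antitone : ∀ ⦃p q : P⦄, p ≤ q → deg q ≤ deg p
  deg_step : ∀ ⦃p q : P⦄, p < q → (∀ r, p ≤ r → r ≤ q → r = p ∨ r = q) → deg p = deg q + 1
  deg_nonneg : ∀ p, 0 ≤ deg p
  finite_up : ∀ p : P, {q : P | p ≤ q}.Finite

/-- A functor from a poset `P` to the category `Ab` of abelian groups. -/
structure PosetFunctor (P : Type) [PartialOrder P] : Type 1 where
  obj : P → Type
  grp : ∀ p, AddCommGroup (obj p)
  map : ∀ {p q : P}, p ≤ q → obj p →+ obj q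
  map_id : ∀ (p : P) (x : obj p), map (le_refl p) x = x
  map_comp : ∀ {p q r : P} (h₁ : p ≤ q) (h₂ : q ≤ r) (x : obj p),
    map h₂ (map h₁ x) = map (h₁.trans h₂) x

attribute [instance] PosetFunctor.grp

variable {P : Type} [PartialOrder P]

/-- A natural transformation between functors `P → Ab`. -/
structure PosetHom (F G : PosetFunctor P) : Type where
  app : ∀ p : P, F.obj p →+ G.obj p
  naturality : ∀ {p q : P} (h : p ≤ q) (x : F.obj p),
    G.map h (app p x) = app q (F.map h x)

/-- The constant functor with value `ℤ`. -/
def constZ (P : Type) [PartialOrder P] : PosetFunctor P where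
  obj _ := ℤ
  grp _ := inferInstance
  map _ := AddMonoidHom.id ℤ
  map_id _ _ := rfl
  map_comp _ _ _ := rfl

namespace PosetFunctor

/-- The inverse limit `lim F` of `F : P → Ab`, realized as the group of compatible
families (sections). -/
def sections (F : PosetFunctor P) : AddSubgroup (∀ p, F.obj p) where
  carrier := {x | ∀ (p q : P) (h : p ≤ q), F.map h (x p) = x q}
  zero_mem' := by intro p q h; simp
  add_mem' := by intro a b ha hb p q h; simp [map_add, ha p q h, hb p q h]
  neg_mem' := by intro a ha p q h; simp [ha p q h]

/-- The functor `F'` with `F'(p₀) = ∏_{p₀ ≤ p} F(p)`; a morphism `p₁ ≤ p₀` acts by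
sending the factor indexed by `p₁ ≤ p` identically to the factor indexed by `p₀ ≤ p`
when `p₀ ≤ p`, and by zero otherwise. -/
def prime (F : PosetFunctor P) : PosetFunctor P where
  obj p₀ := ∀ q : {q : P // p₀ ≤ q}, F.obj q.1
  grp _ := inferInstance
  map h := AddMonoidHom.mk' (fun x q => x ⟨q.1, h.trans q.2⟩) (fun _ _ => rfl)
  map_id _ _ := rfl
  map_comp _ _ _ := rfl

end PosetFunctor

/-- The subgroup `Ker_F(p₀) = ⋂_{p₀ < q} Ker (F(p₀ → q))`. -/
def kerAt (F : PosetFunctor P) (p₀ : P) : AddSubgroup (F.obj p₀) where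
  carrier := {x | ∀ (q : P) (h : p₀ < q), F.map h.le x = 0}
  zero_mem' := by intro q h; simp
  add_mem' := by intro a b ha hb q h; simp [map_add, ha q h, hb q h]
  neg_mem' := by intro a ha q h; simp [ha q h]

/-- `F` is `n`-condensed: `F(p) = 0` for `deg p < n` and `Ker_F(p) = 0` for `deg p > n`. -/
def IsCondensed (G : GradedPoset P) (F : PosetFunctor P) (n : ℕ) : Prop :=
  (∀ p : P, G.deg p < (n : ℤ) → ∀ x : F.obj p, x = 0) ∧
  (∀ p : P, (n : ℤ) < G.deg p → ∀ x ∈ kerAt F p, x = 0)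

/-- The set `(p₀ ↓ P)_n` of objects above `p₀` of degree `n`. -/
def degSet (G : GradedPoset P) (p₀ : P) (n : ℕ) : Set P :=
  {q : P | p₀ ≤ q ∧ G.deg q = (n : ℤ)}

/-- The functor `Ker'_F` (for an `n`-condensed functor `F`):
`Ker'_F(p₀) = ∏_{p ∈ (p₀↓P)_n} F(p)`. -/
def kerPrime (G : GradedPoset P) (F : PosetFunctor P) (n : ℕ) : PosetFunctor P where
  obj p₀ := ∀ q : degSet G p₀ n, F.obj q.1
  grp _ := inferInstance
  map h := AddMonoidHom.mk' (fun x q => x ⟨q.1, h.trans q.2.1, q.2.2⟩) (fun _ _ => rfl)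
  map_id _ _ := rfl
  map_comp _ _ _ := rfl

/-- The natural transformation `λ : F ⇒ Ker'_F` with components
`λ_{p₀} = ∏_{p ∈ (p₀↓P)_n} F(p₀ → p)`. -/
def lambdaNT (G : GradedPoset P) (F : PosetFunctor P) (n : ℕ) :
    PosetHom F (kerPrime G F n) where
  app p₀ := AddMonoidHom.mk' (fun x q => F.map q.2.1 x)
    (by intro a b; funext q; exact map_add _ a b)
  naturality := by
    intro p q h x
    funext r
    exact (F.map_comp h r.2.1 x).symm

/-! ### The cochain complex computing higher inverse limits -/

/-- Composable chains `p₀ ≤ p₁ ≤ … ≤ pₙ` in `P`. -/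
def ChainP (P : Type) [PartialOrder P] (n : ℕ) : Type :=
  {c : Fin (n + 1) → P // Monotone c}

/-- `n`-cochains of the cobar complex computing the derived functors of `lim` over `P`
with coefficients in `F`. -/
abbrev cochain (F : PosetFunctor P) (n : ℕ) : Type :=
  ∀ c : ChainP P n, F.obj (c.1 (Fin.last n))

/-- The `i`-th face of a chain. -/
def chainFace {n : ℕ} (i : Fin (n + 2)) (c : ChainP P (n + 1)) : ChainP P n :=
  ⟨c.1 ∘ i.succAbove, c.2.comp (Fin.strictMono_succAbove i).monotone⟩

/-- The differential of the cobar complex. -/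
noncomputable def cobarDiff (F : PosetFunctor P) (n : ℕ) : cochain F n →+ cochain F (n + 1) :=
  AddMonoidHom.mk'
    (fun ψ c => ∑ i : Fin (n + 2),
      ((-1 : ℤ) ^ (i : ℕ)) • F.map (c.2 (Fin.le_last (i.succAbove (Fin.last n))))
        (ψ (chainFace i c)))
    (by
      intro a b; funext c
      refine (Finset.sum_congr rfl fun i _ => ?_).trans Finset.sum_add_distrib
      exact (congrArg (fun y => ((-1 : ℤ) ^ (i : ℕ)) • y)
        (map_add (F.map (c.2 (Fin.le_last (i.succAbove (Fin.last n)))))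
          (a (chainFace i c)) (b (chainFace i c)))).trans (smul_add _ _ _))

/-- Coboundaries of the cobar complex. -/
noncomputable def cobarCoboundaries (F : PosetFunctor P) : ∀ n : ℕ, AddSubgroup (cochain F n)
  | 0 => ⊥
  | n + 1 => (cobarDiff F n).range

/-- `H^n(P; F) = lim^n F`, the cohomology of `P` with coefficients in `F`, computed by
the cobar complex. -/
noncomputable def cohomologyOf (F : PosetFunctor P) (n : ℕ) : Type :=
  (cobarDiff F n).ker ⧸ ((cobarCoboundaries F n).addSubgroupOf (cobarDiff F n).ker)

noncomputable instance (F : PosetFunctor P) (n : ℕ) : AddCommGroup (cohomologyOf F n) :=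
  inferInstanceAs (AddCommGroup (_ ⧸ _))

/-- The `n`-th Betti number of `P` with coefficients in `F`: the rank of `H^n(P;F)`. -/
noncomputable def bettiOf (F : PosetFunctor P) (n : ℕ) : ℕ :=
  Module.finrank ℤ (cohomologyOf F n)

/-! ### Free functors, pure maps, local covering families -/

/-- A functor is free if all its values are finitely generated free abelian groups. -/
def IsFreeFunctor (F : PosetFunctor P) : Prop :=
  ∀ p : P, Module.Free ℤ (F.obj p) ∧ Module.Finite ℤ (F.obj p)

/-- A map of abelian groups is pure if its cokernel is a free abelian group. -/
def IsPureHom {A B : Type} [AddCommGroup A] [AddCommGroup B] (f : A →+ B) : Prop :=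
  Module.Free ℤ (B ⧸ f.range)

/-- Sections of `F` over a subset `S ⊆ P`, i.e. `lim_S F`. -/
def sectionsOnSet (F : PosetFunctor P) (S : Set P) : Set (∀ q : S, F.obj q.1) :=
  {x | ∀ (q r : S) (h : q.1 ≤ r.1), F.map h (x q) = x r}

/-- The restriction map `lim_{(p₀↓P)_*} F → ∏_{q ∈ S} F(q)` (for `S` a set of objects
strictly above `p₀`, realized by intersecting with `{q | p₀ < q}`). -/
def limRestriction (F : PosetFunctor P) (p₀ : P) (S : Set P) :
    ↥(sectionsOnSet F {q : P | p₀ < q}) → ∀ q : ↥(S ∩ {q : P | p₀ < q}), F.obj q.1 :=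
  fun x q => x.1 ⟨q.1, q.2.2⟩

/-- The map `F(p₀) → ∏_{q ∈ S} F(q)` (for `S` a set of objects above `p₀`, realized by
intersecting with `{q | p₀ ≤ q}`). -/
def detMap (F : PosetFunctor P) (p₀ : P) (S : Set P) :
    F.obj p₀ →+ ∀ q : ↥(S ∩ {q : P | p₀ ≤ q}), F.obj q.1 :=
  AddMonoidHom.mk' (fun x q => F.map q.2.2 x) (by intro a b; funext q; exact map_add _ a b)

/-- A local covering family `𝒥 = {J_n^{p₀}}` (Definition 3.4). -/
def IsLCF (G : GradedPoset P) (J : P → ℕ → Set P) : Prop :=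
  (∀ (p : P) (m : ℕ), J p m ⊆ degSet G p m) ∧
  (∀ (p : P) (m : ℕ), (m : ℤ) < G.deg p →
    (⋃ r ∈ J p (m + 1), degSet G r m) = degSet G p m) ∧
  (∀ (p : P) (m : ℕ), ∀ r ∈ J p (m + 1), J r m ⊆ J p m)

/-- `F` (an `n`-condensed free functor) is `𝒥`-determined (Definition 3.5). -/
def IsDetermined (G : GradedPoset P) (J : P → ℕ → Set P) (F : PosetFunctor P) (n : ℕ) :
    Prop :=
  (∀ p₀ : P, (n : ℤ) + 1 < G.deg p₀ →
    Function.Injective (limRestriction F p₀ (J p₀ n)) ∧ IsPureHom (detMap F p₀ (J p₀ n))) ∧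
  (∀ p₀ : P, G.deg p₀ = (n : ℤ) + 1 →
    IsPureHom (detMap F p₀ (J p₀ n)) ∧ Function.Injective (detMap F p₀ (J p₀ n)))

/-- The finite set `(p↓P)_n`. -/
noncomputable def degFinset (G : GradedPoset P) (p : P) (n : ℕ) : Finset P :=
  ((G.finite_up p).subset
    (show degSet G p n ⊆ {q : P | p ≤ q} from fun _ hq => hq.1)).toFinset

/-- The numbers `R_n^{p₀}` (Definition 4.1). -/
noncomputable def Rnum (G : GradedPoset P) : ℕ → P → ℤ
  | 0, _ => 1
  | m + 1, p => (∑ q ∈ degFinset G p m, Rnum G m q) - Rnum G m p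

/-- The finite set `J_n^p` (as a `Finset`, using finiteness of up-sets). -/
noncomputable def JFinset (G : GradedPoset P) (J : P → ℕ → Set P) (p : P) (n : ℕ) :
    Finset P :=
  ((G.finite_up p).inter_of_left (J p n)).toFinset

/-- Connectedness of a subset of a poset, viewed as a full subcategory. -/
def IsConnectedSet (S : Set P) : Prop :=
  S.Nonempty ∧ ∀ a b : S, Relation.ReflTransGen (fun x y : S => x.1 ≤ y.1 ∨ y.1 ≤ x.1) a b

/-- An adequate local covering family (Definition 4.2). -/
def IsAdequate (G : GradedPoset P) (J : P → ℕ → Set P) : Prop :=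
  IsLCF G J ∧
  (∀ p : P, 2 ≤ G.deg p → IsConnectedSet {q : P | p < q}) ∧
  (∀ (m : ℕ) (p : P), (m : ℤ) + 1 ≤ G.deg p →
    Rnum G m p = ∑ q ∈ JFinset G J p m, Rnum G m q)

/-! ### The global complex and global covering families -/

/-- Restriction of a product of abelian groups to a subset of the index set. -/
def restrictTo {ι : Type} {A : ι → Type} [∀ i, AddCommGroup (A i)] (S : Set ι) :
    (∀ i, A i) →+ ∀ i : S, A i.1 :=
  AddMonoidHom.mk' (fun x i => x i.1) (fun _ _ => rfl)

open Classical in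
/-- Extension by zero of a family indexed by a subset of the index set. -/
noncomputable def extendZero {ι : Type} {A : ι → Type} [∀ i, AddCommGroup (A i)]
    (S : Set ι) : (∀ i : S, A i.1) →+ ∀ i, A i :=
  AddMonoidHom.mk' (fun x i => if h : i ∈ S then x ⟨i, h⟩ else 0)
    (by intro a b; funext i; by_cases h : i ∈ S <;> simp [h])

/-- The map on full products induced by a natural transformation
`π : Ker'_F ⇒ F'` (the building block of the differential `d = ι ∘ ω`). -/
noncomputable def dhat (G : GradedPoset P) {F F' : PosetFunctor P} (n : ℕ)
    (π : PosetHom (kerPrime G F n) F') : (∀ p : P, F.obj p) →+ ∀ p : P, F'.obj p :=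
  AddMonoidHom.mk' (fun x p => π.app p (fun q => x q.1))
    (by intro a b; funext p; exact map_add (π.app p) _ _)

/-- The set `Ob_n(P)` of objects of degree `n`. -/
def obSet (G : GradedPoset P) (n : ℕ) : Set P := {p : P | G.deg p = (n : ℤ)}

/-- The differential `d_n = ι_{n+1} ∘ ω_{n+1} : ∏_{Ob_n} F_n(p) → ∏_{Ob_{n+1}} F_{n+1}(p)`. -/
noncomputable def obDiff (G : GradedPoset P) (F : ℕ → PosetFunctor P)
    (π : ∀ n : ℕ, PosetHom (kerPrime G (F n) n) (F (n + 1))) (n : ℕ) :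
    (∀ p : ↥(obSet G n), (F n).obj p.1) →+ ∀ p : ↥(obSet G (n + 1)), (F (n + 1)).obj p.1 :=
  (restrictTo (obSet G (n + 1))).comp ((dhat G n (π n)).comp (extendZero (obSet G n)))

/-- The composite `∏_{p ∈ Ob_n(P)∖K_n} F_n(p) → ∏_{p ∈ K_{n+1}} F_{n+1}(p)`
induced by the differential. -/
noncomputable def wMap (G : GradedPoset P) (F : ℕ → PosetFunctor P)
    (π : ∀ n : ℕ, PosetHom (kerPrime G (F n) n) (F (n + 1))) (K : ℕ → Set P) (n : ℕ) :
    (∀ p : ↥(obSet G n \ K n), (F n).obj p.1) →+ ∀ p : ↥(K (n + 1)), (F (n + 1)).obj p.1 :=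
  (restrictTo (K (n + 1))).comp ((dhat G n (π n)).comp (extendZero (obSet G n \ K n)))

/-- A global covering family (Definition 5.1). -/
def IsGCF (G : GradedPoset P) (F : ℕ → PosetFunctor P)
    (π : ∀ n : ℕ, PosetHom (kerPrime G (F n) n) (F (n + 1))) (K : ℕ → Set P) : Prop :=
  (∀ n : ℕ, K n ⊆ obSet G n) ∧
  (∀ n : ℕ, Function.Injective
    (fun (s : ↥(PosetFunctor.sections (F n))) => (fun p : ↥(K n) => s.1 p.1))) ∧
  (∀ n : ℕ, IsPureHom (wMap G F π K n))

/-- `Ob_n(P)` as a `Finset` (given that each degree level is finite). -/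
noncomputable def obFinset (G : GradedPoset P)
    (hfin : ∀ i : ℤ, {p : P | G.deg p = i}.Finite) (n : ℕ) : Finset P :=
  (hfin (n : ℤ)).toFinset

/-- `K_n` as a `Finset`. -/
noncomputable def KFinset (G : GradedPoset P)
    (hfin : ∀ i : ℤ, {p : P | G.deg p = i}.Finite) (K : ℕ → Set P) (n : ℕ) : Finset P :=
  ((hfin (n : ℤ)).inter_of_left (K n)).toFinset

/-- The Betti numbers `b_n^𝒦` of a global covering family (Definition 5.2). -/
noncomputable def bettiK (G : GradedPoset P)
    (hfin : ∀ i : ℤ, {p : P | G.deg p = i}.Finite) (K : ℕ → Set P) : ℕ → ℤ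
  | 0 => ∑ p ∈ KFinset G hfin K 0, Rnum G 0 p
  | n + 1 =>
      (∑ p ∈ KFinset G hfin K n, Rnum G n p) - (∑ p ∈ obFinset G hfin n, Rnum G n p) +
        ∑ p ∈ KFinset G hfin K (n + 1), Rnum G (n + 1) p

/-- The sequence of functors `F_0 = c_ℤ, F_1, F_2, …` of Proposition 4.3, together with
the connecting short exact sequences `0 → F_{n-1} → Ker'_{F_{n-1}} → F_n → 0` and all
their properties. -/
structure CondensedSequence (G : GradedPoset P) (J : P → ℕ → Set P) : Type 1 where
  F : ℕ → PosetFunctor P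
  pi : ∀ n : ℕ, PosetHom (kerPrime G (F n) n) (F (n + 1))
  F_zero : F 0 = constZ P
  pi_surj : ∀ (n : ℕ) (p : P), Function.Surjective ((pi n).app p)
  pi_ker : ∀ (n : ℕ) (p : P), ((pi n).app p).ker = ((lambdaNT G (F n) n).app p).range
  condensed : ∀ n : ℕ, IsCondensed G (F n) n
  free : ∀ n : ℕ, IsFreeFunctor (F n)
  determined : ∀ n : ℕ, IsDetermined G J (F n) n
  rank_eq : ∀ (n : ℕ) (p : P), (n : ℤ) ≤ G.deg p →
    (Module.finrank ℤ ((F n).obj p) : ℤ) = Rnum G n p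

/-! ### Simplex-like posets -/

/-- The poset `Δ_n` of faces of the standard `n`-dimensional simplex, ordered by
inclusion: faces are the nonempty subsets of the vertex set. -/
def SimplexPoset (n : ℕ) : Type := {s : Finset (Fin (n + 1)) // s.Nonempty}

instance (n : ℕ) : PartialOrder (SimplexPoset n) := Subtype.partialOrder _

/-- A poset `P` is simplex-like (with dimension function `d`) if for every `p` the
category `(P ↓ p)` is isomorphic to `Δ_{d p}`. -/
def SimplexLike (P : Type) [PartialOrder P] (d : P → ℕ) : Prop :=
  ∀ p : P, Nonempty ({q : P // q ≤ p} ≃o SimplexPoset (d p))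

theorem cobarDiff_apply (F : PosetFunctor P) (n : ℕ) (ψ : cochain F n) (c : ChainP P (n + 1)) :
    cobarDiff F n ψ c = ∑ i : Fin (n + 2),
      ((-1 : ℤ) ^ (i : ℕ)) • F.map (c.2 (Fin.le_last (i.succAbove (Fin.last n))))
        (ψ (chainFace i c)) := rfl

open CategoryTheory in
/-- The cosimplicial abelian group of cochains. -/
def cochainCosimplicial (F : PosetFunctor P) : CosimplicialObject AddCommGrpCat.{0} where
  obj n := AddCommGrpCat.of (cochain F n.len)
  map {m n} f := AddCommGrpCat.ofHom (AddMonoidHom.mk'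
    (fun (ψ : cochain F m.len) (c : ChainP P n.len) =>
      F.map (c.2 (Fin.le_last (f.toOrderHom (Fin.last m.len))))
        (ψ ⟨c.1 ∘ f.toOrderHom, c.2.comp f.toOrderHom.monotone⟩))
    (by intro a b; funext c; exact map_add (F.map _) _ _))
  map_id n := by
    ext ψ c
    exact F.map_id _ _
  map_comp f g := by
    ext ψ c
    exact (F.map_comp _ _ _).symm

open CategoryTheory in
theorem cobarDiff_eq (F : PosetFunctor P) (n : ℕ) :
    AddCommGrpCat.ofHom (cobarDiff F n) =
      AlgebraicTopology.AlternatingCofaceMapComplex.objD (cochainCosimplicial F) n := by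
  ext ψ c
  let ev : (AddCommGrpCat.of (cochain F n) ⟶ AddCommGrpCat.of (cochain F (n + 1))) →+
      F.obj (c.1 (Fin.last (n + 1))) :=
    AddMonoidHom.mk' (fun f => (f.hom ψ : cochain F (n + 1)) c) (fun _ _ => rfl)
  change _ = ev (∑ i : Fin (n + 2), (-1 : ℤ) ^ (i : ℕ) • (cochainCosimplicial F).δ i)
  refine (cobarDiff_apply F n ψ c).trans (Eq.trans ?_ (map_sum ev (fun i : Fin (n + 2) => (-1 : ℤ) ^ (i : ℕ) •
    ((cochainCosimplicial F).δ i :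
      AddCommGrpCat.of (cochain F n) ⟶ AddCommGrpCat.of (cochain F (n + 1)))) Finset.univ).symm)
  refine Finset.sum_congr rfl fun i _ => ?_
  exact (map_zsmul ev ((-1 : ℤ) ^ (i : ℕ)) ((cochainCosimplicial F).δ i :
      AddCommGrpCat.of (cochain F n) ⟶ AddCommGrpCat.of (cochain F (n + 1)))).symm

open CategoryTheory in
theorem cobarDiff_sq (F : PosetFunctor P) (n : ℕ) (ψ : cochain F n) :
    cobarDiff F (n + 1) (cobarDiff F n ψ) = 0 := by
  have h := AlgebraicTopology.AlternatingCofaceMapComplex.d_squared (cochainCosimplicial F) n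
  rw [← cobarDiff_eq, ← cobarDiff_eq] at h
  have := congrArg (fun g => g.hom ψ) h
  exact this

/-- Cochain map induced by a natural transformation. -/
def homCochain {F F' : PosetFunctor P} (η : PosetHom F F') (n : ℕ) :
    cochain F n →+ cochain F' n :=
  AddMonoidHom.mk' (fun ψ c => η.app _ (ψ c)) (by intro a b; funext c; exact map_add _ _ _)

theorem homCochain_comm {F F' : PosetFunctor P} (η : PosetHom F F') (n : ℕ) (ψ : cochain F n) :
    cobarDiff F' n (homCochain η n ψ) = homCochain η (n + 1) (cobarDiff F n ψ) := by
  funext c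
  change _ = η.app _ (cobarDiff F n ψ c)
  rw [cobarDiff_apply, cobarDiff_apply, map_sum]
  refine Finset.sum_congr rfl fun i _ => ?_
  rw [map_zsmul]
  congr 1
  exact η.naturality _ _

/-- Append a top element to a chain. -/
def snocChain {n : ℕ} (c : ChainP P n) (q : P) (h : c.1 (Fin.last n) ≤ q) : ChainP P (n + 1) :=
  ⟨Fin.snoc (α := fun _ => P) c.1 q, by
    intro i j hij
    induction j using Fin.lastCases with
    | last =>
      rw [Fin.snoc_last]
      induction i using Fin.lastCases with
      | last => rw [Fin.snoc_last]
      | cast i => rw [Fin.snoc_castSucc]; exact (c.2 (Fin.le_last i)).trans h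
    | cast j =>
      induction i using Fin.lastCases with
      | last => exact absurd hij (not_le.2 (Fin.castSucc_lt_last j))
      | cast i =>
        rw [Fin.snoc_castSucc, Fin.snoc_castSucc]
        exact c.2 (Fin.castSucc_le_castSucc_iff.1 hij)⟩

theorem snocChain_last {n : ℕ} (c : ChainP P n) (q : P) (h : c.1 (Fin.last n) ≤ q) :
    (snocChain c q h).1 (Fin.last (n + 1)) = q :=
  Fin.snoc_last (α := fun _ => P) q c.1

theorem chainFace_castSucc_snoc {n : ℕ} (c : ChainP P (n + 1)) (q : P)
    (h : c.1 (Fin.last (n + 1)) ≤ q) (i : Fin (n + 2)) :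
    chainFace i.castSucc (snocChain c q h) =
      snocChain (chainFace i c) q ((c.2 (Fin.le_last _)).trans h) := by
  apply Subtype.ext
  funext j
  simp only [chainFace, snocChain, Function.comp]
  induction j using Fin.lastCases with
  | last => rw [Fin.succAbove_ne_last_last (Fin.castSucc_lt_last i).ne, Fin.snoc_last, Fin.snoc_last]
  | cast j => rw [Fin.castSucc_succAbove_castSucc, Fin.snoc_castSucc, Fin.snoc_castSucc]; rfl

theorem chainFace_last_snoc {n : ℕ} (c : ChainP P n) (q : P)
    (h : c.1 (Fin.last n) ≤ q) :
    chainFace (Fin.last (n + 1)) (snocChain c q h) = c := by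
  apply Subtype.ext
  funext j
  simp only [chainFace, snocChain, Function.comp]
  rw [Fin.succAbove_last_apply, Fin.snoc_castSucc]

theorem kerPrime_eval_congr (G : GradedPoset P) (F : PosetFunctor P) (n m : ℕ)
    (ψ : cochain (kerPrime G F n) m) {c c' : ChainP P m} (e : c = c') (q : P)
    (h : q ∈ degSet G (c.1 (Fin.last m)) n) (h' : q ∈ degSet G (c'.1 (Fin.last m)) n) :
    ψ c ⟨q, h⟩ = ψ c' ⟨q, h'⟩ := by
  subst e; rfl

theorem cobarDiff_kerPrime_apply (G : GradedPoset P) (F : PosetFunctor P) (n m : ℕ)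
    (ψ : cochain (kerPrime G F n) m) (c : ChainP P (m + 1)) (q : P)
    (h : q ∈ degSet G (c.1 (Fin.last (m + 1))) n) :
    cobarDiff (kerPrime G F n) m ψ c ⟨q, h⟩ = ∑ i : Fin (m + 2), ((-1 : ℤ) ^ (i : ℕ)) •
      ψ (chainFace i c) ⟨q, (c.2 (Fin.le_last (i.succAbove (Fin.last m)))).trans h.1, h.2⟩ := by
  rw [cobarDiff_apply]
  let ev : (kerPrime G F n).obj (c.1 (Fin.last (m + 1))) →+ F.obj q :=
    AddMonoidHom.mk' (fun f => f ⟨q, h⟩) (fun _ _ => rfl)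
  refine (map_sum ev (fun i : Fin (m + 2) => ((-1 : ℤ) ^ (i : ℕ)) •
    (kerPrime G F n).map (c.2 (Fin.le_last (i.succAbove (Fin.last m))))
        (ψ (chainFace i c))) Finset.univ).trans ?_
  exact Finset.sum_congr rfl fun i _ => map_zsmul ev _ _

theorem sign_aux {M : Type} [AddCommGroup M] (m : ℕ) (s a : M)
    (h : s + (-1 : ℤ) ^ (m + 2) • a = 0) : (-1 : ℤ) ^ (m + 1) • s = a := by
  rw [eq_neg_of_add_eq_zero_left h, ← neg_smul, smul_smul]
  have h1 : (-1 : ℤ) ^ (m + 1) * (-1) ^ (m + 1) = 1 := by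
    rw [← mul_pow]; simp
  have : (-1 : ℤ) ^ (m + 1) * -(-1) ^ (m + 2) = 1 := by
    rw [pow_succ (-1 : ℤ) (m + 1)]
    linarith
  rw [this, one_smul]

/-- `Ker'_F` is acyclic. -/
theorem kerPrime_acyclic (G : GradedPoset P) (F : PosetFunctor P) (n m : ℕ)
    (ψ : cochain (kerPrime G F n) (m + 1)) (hψ : cobarDiff (kerPrime G F n) (m + 1) ψ = 0) :
    ∃ φ, cobarDiff (kerPrime G F n) m φ = ψ := by
  let hh : cochain (kerPrime G F n) m := fun c r =>
    ψ (snocChain c r.1 r.2.1) ⟨r.1, (snocChain_last c r.1 r.2.1).le, r.2.2⟩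
  refine ⟨(-1 : ℤ) ^ (m + 1) • hh, ?_⟩
  rw [map_zsmul]
  funext c
  funext r
  obtain ⟨q, hq⟩ := r
  change (-1 : ℤ) ^ (m + 1) • (cobarDiff (kerPrime G F n) m hh c ⟨q, hq⟩) = _
  have h1 := (cobarDiff_kerPrime_apply G F n (m + 1) ψ (snocChain c q hq.1) q
    ⟨(snocChain_last c q hq.1).le, hq.2⟩).symm.trans
      (congrFun (congrFun hψ (snocChain c q hq.1)) ⟨q, (snocChain_last c q hq.1).le, hq.2⟩)
  rw [Fin.sum_univ_castSucc] at h1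
  refine (congrArg (fun z => (-1 : ℤ) ^ (m + 1) • z)
    (cobarDiff_kerPrime_apply G F n m hh c q hq)).trans ?_
  have h2 : ∀ i : Fin (m + 2), ((-1 : ℤ) ^ (i : ℕ)) • hh (chainFace i c)
      ⟨q, (c.2 (Fin.le_last (i.succAbove (Fin.last m)))).trans hq.1, hq.2⟩ =
      ((-1 : ℤ) ^ (i.castSucc : ℕ)) • ψ (chainFace i.castSucc (snocChain c q hq.1))
        ⟨q, ((snocChain c q hq.1).2 (Fin.le_last
          (i.castSucc.succAbove (Fin.last (m + 1))))).trans (snocChain_last c q hq.1).le,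
          hq.2⟩ := by
    intro i
    congr 1
    exact kerPrime_eval_congr G F n (m + 1) ψ (chainFace_castSucc_snoc c q hq.1 i).symm q _ _
  have h3 := kerPrime_eval_congr G F n (m + 1) ψ (chainFace_last_snoc c q hq.1) q
    ⟨((snocChain c q hq.1).2 (Fin.le_last
      ((Fin.last (m + 2)).succAbove (Fin.last (m + 1))))).trans (snocChain_last c q hq.1).le,
          hq.2⟩ hq
  exact sign_aux m _ _ ((congrArg₂ (fun a b => a + b) (Finset.sum_congr rfl fun i _ => h2 i)
    (congrArg (fun z => (-1 : ℤ) ^ (m + 2) • z) h3.symm)).trans h1)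

theorem nonempty_equiv_of_surj {T X Y : Type} [AddCommGroup T] [AddCommGroup X] [AddCommGroup Y]
    (f : T →+ X) (g : T →+ Y) (hf : Function.Surjective f) (hg : Function.Surjective g)
    (h : ∀ t, f t = 0 ↔ g t = 0) : Nonempty (X ≃+ Y) := by
  have hk : f.ker = g.ker := by
    ext t; exact h t
  exact ⟨(QuotientAddGroup.quotientKerEquivOfSurjective f hf).symm.trans
    ((QuotientAddGroup.quotientAddEquivOfEq hk).trans
      (QuotientAddGroup.quotientKerEquivOfSurjective g hg))⟩

theorem shift_abstract {A0 A1 A2 B0 B1 B2 C0 C1 : Type} [AddCommGroup A0] [AddCommGroup A1]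
    [AddCommGroup A2] [AddCommGroup B0] [AddCommGroup B1] [AddCommGroup B2] [AddCommGroup C0]
    [AddCommGroup C1] (dA0 : A0 →+ A1) (dA1 : A1 →+ A2) (dB0 : B0 →+ B1) (dB1 : B1 →+ B2)
    (dC0 : C0 →+ C1) (i0 : A0 →+ B0) (i1 : A1 →+ B1) (i2 : A2 →+ B2) (p0 : B0 →+ C0)
    (p1 : B1 →+ C1) (ci0 : ∀ a, dB0 (i0 a) = i1 (dA0 a)) (ci1 : ∀ a, dB1 (i1 a) = i2 (dA1 a))
    (cp0 : ∀ b, dC0 (p0 b) = p1 (dB0 b)) (hB : ∀ b, dB1 (dB0 b) = 0)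
    (hi1 : Function.Injective i1) (hi2 : Function.Injective i2) (hp0 : Function.Surjective p0)
    (e0 : ∀ b, p0 b = 0 ↔ ∃ a, i0 a = b) (e1 : ∀ b, p1 b = 0 ↔ ∃ a, i1 a = b)
    (hex : ∀ b, dB1 b = 0 → ∃ y, dB0 y = b) (D : AddSubgroup C0)
    (hD : D = dB0.ker.map p0) :
    Nonempty ((↥dC0.ker ⧸ D.addSubgroupOf dC0.ker) ≃+
      (↥dA1.ker ⧸ dA0.range.addSubgroupOf dA1.ker)) := by
  subst hD
  let T : AddSubgroup (B0 × A1) :=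
    (dB0.comp (AddMonoidHom.fst B0 A1) - i1.comp (AddMonoidHom.snd B0 A1)).ker
  have hT : ∀ t : T, dB0 t.1.1 = i1 t.1.2 := fun t => sub_eq_zero.1 t.2
  let g : T →+ ↥dA1.ker := (((AddMonoidHom.snd B0 A1).comp T.subtype)).codRestrict _ (by
    intro t
    apply hi2
    change i2 (dA1 t.1.2) = _
    rw [← ci1, ← hT, hB, map_zero])
  let f : T →+ ↥dC0.ker := ((p0.comp ((AddMonoidHom.fst B0 A1).comp T.subtype))).codRestrict _ (by
    intro t
    change dC0 (p0 t.1.1) = 0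
    rw [cp0, hT]
    exact (e1 _).2 ⟨_, rfl⟩)
  refine nonempty_equiv_of_surj ((QuotientAddGroup.mk' _).comp f)
    ((QuotientAddGroup.mk' _).comp g) ?_ ?_ ?_
  · refine (QuotientAddGroup.mk'_surjective _).comp ?_
    rintro ⟨c, hc⟩
    obtain ⟨y, rfl⟩ := hp0 c
    have hc' : dC0 (p0 y) = 0 := hc
    rw [cp0] at hc'
    obtain ⟨w, hw⟩ := (e1 _).1 hc'
    exact ⟨⟨(y, w), sub_eq_zero.2 hw.symm⟩, rfl⟩
  · refine (QuotientAddGroup.mk'_surjective _).comp ?_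
    rintro ⟨w, hw⟩
    have hw' : dA1 w = 0 := hw
    obtain ⟨y, hy⟩ := hex (i1 w) (by rw [ci1, hw', map_zero])
    exact ⟨⟨(y, w), sub_eq_zero.2 hy⟩, rfl⟩
  · intro t
    refine (QuotientAddGroup.eq_zero_iff (f t)).trans
      (Iff.trans ?_ (QuotientAddGroup.eq_zero_iff (g t)).symm)
    rw [AddSubgroup.mem_addSubgroupOf, AddSubgroup.mem_addSubgroupOf]
    change (∃ z, dB0 z = 0 ∧ p0 z = p0 t.1.1) ↔ (∃ a, dA0 a = t.1.2)
    constructor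
    · rintro ⟨z, hz, hzt⟩
      obtain ⟨a, ha⟩ := (e0 (t.1.1 - z)).1 (by rw [map_sub, hzt, sub_self])
      refine ⟨a, hi1 ?_⟩
      rw [← ci0, ha, map_sub, hz, sub_zero, hT]
    · rintro ⟨a, ha⟩
      refine ⟨t.1.1 - i0 a, ?_, ?_⟩
      · rw [map_sub, ci0, ha, hT, sub_self]
      · rw [map_sub, (e0 (i0 a)).2 ⟨a, rfl⟩, sub_zero]

theorem homCochain_injective {F F' : PosetFunctor P} (η : PosetHom F F')
    (h : ∀ p, Function.Injective (η.app p)) (n : ℕ) : Function.Injective (homCochain η n) := by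
  intro a b hab
  funext c
  exact h _ (congrFun hab c)

theorem homCochain_surjective {F F' : PosetFunctor P} (η : PosetHom F F')
    (h : ∀ p, Function.Surjective (η.app p)) (n : ℕ) : Function.Surjective (homCochain η n) := by
  intro b
  exact ⟨fun c => (h _ (b c)).choose, funext fun c => (h _ (b c)).choose_spec⟩

theorem homCochain_exact {F F' F'' : PosetFunctor P} (η : PosetHom F F') (θ : PosetHom F' F'')
    (h : ∀ p, (θ.app p).ker = (η.app p).range) (n : ℕ) (b : cochain F' n) :
    homCochain θ n b = 0 ↔ ∃ a, homCochain η n a = b := by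
  constructor
  · intro hb
    have : ∀ c, ∃ a, η.app _ a = b c := by
      intro c
      have h1 : b c ∈ (θ.app (c.1 (Fin.last n))).ker := congrFun hb c
      rw [h] at h1
      exact h1
    exact ⟨fun c => (this c).choose, funext fun c => (this c).choose_spec⟩
  · rintro ⟨a, rfl⟩
    funext c
    have h1 : η.app _ (a c) ∈ (η.app (c.1 (Fin.last n))).range := ⟨_, rfl⟩
    rw [← h] at h1
    exact h1

/-- The general dimension shift. -/
theorem cobar_shift (G : GradedPoset P) (n : ℕ) {F F'' : PosetFunctor P}
    (η : PosetHom F (kerPrime G F n))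
    (θ : PosetHom (kerPrime G F n) F'') (hη : ∀ p, Function.Injective (η.app p))
    (hθ : ∀ p, Function.Surjective (θ.app p)) (h : ∀ p, (θ.app p).ker = (η.app p).range) (k : ℕ)
    (D : AddSubgroup (cochain F'' k))
    (hD : D = (cobarDiff (kerPrime G F n) k).ker.map (homCochain θ k)) :
    Nonempty ((↥(cobarDiff F'' k).ker ⧸ D.addSubgroupOf (cobarDiff F'' k).ker) ≃+
      cohomologyOf F (k + 1)) :=
  shift_abstract (cobarDiff F k) (cobarDiff F (k + 1)) (cobarDiff (kerPrime G F n) k)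
    (cobarDiff (kerPrime G F n) (k + 1)) (cobarDiff F'' k) (homCochain η k)
    (homCochain η (k + 1)) (homCochain η (k + 2)) (homCochain θ k) (homCochain θ (k + 1))
    (homCochain_comm η k) (homCochain_comm η (k + 1)) (homCochain_comm θ k)
    (cobarDiff_sq _ k) (homCochain_injective η hη _) (homCochain_injective η hη _)
    (homCochain_surjective θ hθ _) (homCochain_exact η θ h _) (homCochain_exact η θ h _)
    (kerPrime_acyclic G F n k) D hD

theorem cobar_shift_succ (G : GradedPoset P) (n : ℕ) {F F'' : PosetFunctor P}
    (η : PosetHom F (kerPrime G F n))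
    (θ : PosetHom (kerPrime G F n) F'') (hη : ∀ p, Function.Injective (η.app p))
    (hθ : ∀ p, Function.Surjective (θ.app p)) (h : ∀ p, (θ.app p).ker = (η.app p).range) (k : ℕ) :
    Nonempty (cohomologyOf F'' (k + 1) ≃+ cohomologyOf F (k + 1 + 1)) := by
  refine cobar_shift G n η θ hη hθ h (k + 1) (cobarDiff F'' k).range ?_
  ext x
  constructor
  · rintro ⟨y, rfl⟩
    obtain ⟨z, rfl⟩ := homCochain_surjective θ hθ k y
    exact ⟨cobarDiff _ k z, cobarDiff_sq _ k z, (homCochain_comm θ k z).symm⟩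
  · rintro ⟨y, hy, rfl⟩
    obtain ⟨z, rfl⟩ := kerPrime_acyclic G F n k y hy
    exact ⟨homCochain θ k z, homCochain_comm θ k z⟩

theorem lambda_injective (G : GradedPoset P) (F : PosetFunctor P) (n : ℕ)
    (hF : IsCondensed G F n) (p : P) (x : F.obj p)
    (hx : ∀ (q : P) (h : p ≤ q), G.deg q = (n : ℤ) → F.map h x = 0) : x = 0 := by
  induction hN : {q : P | p ≤ q}.ncard using Nat.strong_induction_on generalizing p with
  | _ N ih =>
    rcases lt_trichotomy (G.deg p) (n : ℤ) with h | h | h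
    · exact hF.1 p h x
    · have := hx p le_rfl h
      rwa [F.map_id] at this
    · refine hF.2 p h x ?_
      intro q hq
      refine ih _ ?_ q (F.map hq.le x) ?_ rfl
      · rw [← hN]
        refine Set.ncard_lt_ncard ?_ (G.finite_up p)
        refine ⟨fun r hr => hq.le.trans hr, fun hs => ?_⟩
        exact absurd (hs (le_refl p)) (not_le_of_gt hq)
      · intro r hr hd
        rw [F.map_comp]
        exact hx r _ hd

theorem lambda_app_injective (G : GradedPoset P) (F : PosetFunctor P) (n : ℕ)
    (hF : IsCondensed G F n) (p : P) : Function.Injective ((lambdaNT G F n).app p) := by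
  rw [injective_iff_map_eq_zero]
  intro x hx
  exact lambda_injective G F n hF p x fun q h hd => congrFun hx ⟨q, h, hd⟩

theorem iterated_shift {G : GradedPoset P} {J : P → ℕ → Set P} (S : CondensedSequence G J)
    (n : ℕ) : ∀ m : ℕ, Nonempty (cohomologyOf (S.F n) (m + 1) ≃+
      cohomologyOf (S.F 0) (m + n + 1)) := by
  induction n with
  | zero => exact fun m => ⟨AddEquiv.refl _⟩
  | succ n ih =>
    intro m
    obtain ⟨e⟩ := cobar_shift_succ G n (lambdaNT G (S.F n) n) (S.pi n)
      (lambda_app_injective G _ n (S.condensed n)) (S.pi_surj n) (S.pi_ker n) m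
    obtain ⟨e'⟩ := ih (m + 1)
    have : m + (n + 1) + 1 = m + 1 + n + 1 := by omega
    rw [this]
    exact ⟨e.trans e'⟩

/-! ### Sections -/

/-- A family as a `0`-cochain. -/
def toCochainZero (F : PosetFunctor P) : (∀ p, F.obj p) →+ cochain F 0 :=
  AddMonoidHom.mk' (fun x c => x (c.1 (Fin.last 0))) (fun _ _ => rfl)

theorem toCochainZero_surjective (F : PosetFunctor P) :
    Function.Surjective (toCochainZero F) := by
  intro ψ
  refine ⟨fun p => ψ ⟨fun _ => p, fun _ _ _ => le_rfl⟩, ?_⟩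
  funext c
  have : ∀ (c' : ChainP P 0), c' = c → ∀ h : c'.1 (Fin.last 0) ≤ c.1 (Fin.last 0),
      F.map h (ψ c') = ψ c := by
    rintro _ rfl h
    exact F.map_id _ _
  have h2 := this ⟨fun _ => c.1 (Fin.last 0), fun _ _ _ => le_rfl⟩
    (Subtype.ext (funext fun j => by
      have : j = Fin.last 0 := Fin.ext (by have := j.2; simp only [Fin.val_last]; omega)
      rw [this])) le_rfl
  rw [F.map_id] at h2
  exact h2

theorem toCochainZero_injective (F : PosetFunctor P) :
    Function.Injective (toCochainZero F) := by
  intro x y h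
  funext p
  exact congrFun h ⟨fun _ => p, fun _ _ _ => le_rfl⟩

theorem toCochainZero_cocycle (F : PosetFunctor P) (x : ∀ p, F.obj p) :
    cobarDiff F 0 (toCochainZero F x) = 0 ↔ x ∈ F.sections := by
  have key : ∀ c : ChainP P 1, cobarDiff F 0 (toCochainZero F x) c =
      x (c.1 1) - F.map (c.2 (Fin.zero_le 1)) (x (c.1 0)) := by
    intro c
    rw [cobarDiff_apply, Fin.sum_univ_two]
    have h0 : F.map (c.2 (Fin.le_last ((0 : Fin 2).succAbove (Fin.last 0))))
        (toCochainZero F x (chainFace 0 c)) = x (c.1 1) := F.map_id _ _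
    have h1 : F.map (c.2 (Fin.le_last ((1 : Fin 2).succAbove (Fin.last 0))))
        (toCochainZero F x (chainFace 1 c)) = F.map (c.2 (Fin.zero_le 1)) (x (c.1 0)) := rfl
    rw [h0, h1, sub_eq_add_neg]
    simp only [Fin.val_zero, Fin.val_one, pow_zero, pow_one, one_smul, neg_smul]
  constructor
  · intro h p q hpq
    have hm : Monotone ![p, q] := by
      intro i j hij
      fin_cases i <;> fin_cases j <;> first | exact le_rfl | exact hpq | exact absurd hij (by decide)
    have h1 := key ⟨![p, q], hm⟩
    rw [h] at h1
    exact (sub_eq_zero.1 h1.symm).symm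
  · intro h
    funext c
    rw [key]
    exact sub_eq_zero.2 (h _ _ _).symm

/-- Sections are the `0`-cocycles. -/
noncomputable def sectionsToCocycles (F : PosetFunctor P) : F.sections →+ (cobarDiff F 0).ker :=
  ((toCochainZero F).comp F.sections.subtype).codRestrict _
    (fun s => (toCochainZero_cocycle F s.1).2 s.2)

theorem sectionsToCocycles_surjective (F : PosetFunctor P) :
    Function.Surjective (sectionsToCocycles F) := by
  rintro ⟨ψ, hψ⟩
  obtain ⟨x, rfl⟩ := toCochainZero_surjective F ψ
  exact ⟨⟨x, (toCochainZero_cocycle F x).1 hψ⟩, rfl⟩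

theorem dhat_extend (G : GradedPoset P) {F F' : PosetFunctor P} (n : ℕ)
    (π : PosetHom (kerPrime G F n) F') (x : ∀ p : ↥(obSet G n), F.obj p.1) (p : P) :
    dhat G n π (extendZero (obSet G n) x) p = π.app p (fun q => x ⟨q.1, q.2.2⟩) := by
  change π.app p _ = _
  congr 1
  funext q
  exact dif_pos (show q.1 ∈ obSet G n from q.2.2)

theorem dhat_extend_mem (G : GradedPoset P) {F F' : PosetFunctor P} (n : ℕ)
    (π : PosetHom (kerPrime G F n) F') (x : ∀ p : ↥(obSet G n), F.obj p.1) :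
    dhat G n π (extendZero (obSet G n) x) ∈ F'.sections := by
  intro p q h
  rw [dhat_extend, dhat_extend]
  exact π.naturality h _

theorem section_eq_zero (G : GradedPoset P) (F : PosetFunctor P) (n : ℕ)
    (hF : IsCondensed G F n) (s : ∀ p, F.obj p) (hs : s ∈ F.sections)
    (h : restrictTo (obSet G n) s = 0) : s = 0 := by
  funext p
  refine lambda_injective G F n hF p _ fun q hq hd => ?_
  rw [hs p q hq]
  exact congrFun h ⟨q, hd⟩

theorem obDiff_eq_zero_iff {G : GradedPoset P} {J : P → ℕ → Set P} (S : CondensedSequence G J)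
    (n : ℕ) (x : ∀ p : ↥(obSet G n), (S.F n).obj p.1) :
    obDiff G S.F S.pi n x = 0 ↔ ∃ s ∈ (S.F n).sections, restrictTo (obSet G n) s = x := by
  constructor
  · intro h
    have h0 := section_eq_zero G (S.F (n + 1)) (n + 1) (S.condensed (n + 1)) _
      (dhat_extend_mem G n (S.pi n) x) h
    have h1 : ∀ p, ∃ y, (lambdaNT G (S.F n) n).app p y =
        fun q : degSet G p n => x ⟨q.1, q.2.2⟩ := by
      intro p
      have h2 := congrFun h0 p
      rw [dhat_extend] at h2
      have h3 : (fun q => x ⟨q.1, q.2.2⟩ : (kerPrime G (S.F n) n).obj p) ∈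
        ((S.pi n).app p).ker := h2
      rw [S.pi_ker] at h3
      exact h3
    choose s hs using h1
    refine ⟨s, ?_, ?_⟩
    · intro p q hpq
      apply lambda_app_injective G _ n (S.condensed n) q
      rw [← (lambdaNT G (S.F n) n).naturality, hs, hs]
      rfl
    · funext p
      have := congrFun (hs p.1) ⟨p.1, le_rfl, p.2⟩
      exact ((S.F n).map_id _ _).symm.trans this
  · rintro ⟨s, hs, rfl⟩
    funext p
    change dhat G n (S.pi n) (extendZero (obSet G n) _) p.1 = 0
    rw [dhat_extend]
    have : (fun q => restrictTo (obSet G n) s ⟨q.1, q.2.2⟩ : (kerPrime G (S.F n) n).obj p.1) ∈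
        ((S.pi n).app p.1).ker := by
      rw [S.pi_ker]
      refine ⟨s p.1, ?_⟩
      funext q
      exact hs _ _ _
    exact this

/-- The map `ι_n` with values in the kernel of the differential. -/
noncomputable def sectionsToKer {G : GradedPoset P} {J : P → ℕ → Set P}
    (S : CondensedSequence G J) (n : ℕ) :
    (S.F n).sections →+ (obDiff G S.F S.pi n).ker :=
  ((restrictTo (obSet G n)).comp (S.F n).sections.subtype).codRestrict _
    (fun s => (obDiff_eq_zero_iff S n _).2 ⟨s.1, s.2, rfl⟩)

theorem sectionsToKer_surjective {G : GradedPoset P} {J : P → ℕ → Set P}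
    (S : CondensedSequence G J) (n : ℕ) : Function.Surjective (sectionsToKer S n) := by
  rintro ⟨x, hx⟩
  obtain ⟨s, hs, rfl⟩ := (obDiff_eq_zero_iff S n x).1 hx
  exact ⟨⟨s, hs⟩, rfl⟩

theorem degree_zero {G : GradedPoset P} {J : P → ℕ → Set P} (S : CondensedSequence G J) :
    Nonempty (↥(obDiff G S.F S.pi 0).ker ≃+ cohomologyOf (S.F 0) 0) := by
  let g : (S.F 0).sections →+ cohomologyOf (S.F 0) 0 :=
    (QuotientAddGroup.mk' ((cobarCoboundaries (S.F 0) 0).addSubgroupOf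
      (cobarDiff (S.F 0) 0).ker)).comp (sectionsToCocycles (S.F 0))
  refine nonempty_equiv_of_surj (sectionsToKer S 0) g (sectionsToKer_surjective S 0)
    ((QuotientAddGroup.mk'_surjective _).comp (sectionsToCocycles_surjective _)) ?_
  intro s
  have h1 : sectionsToKer S 0 s = 0 ↔ s.1 = 0 := by
    constructor
    · intro h
      exact section_eq_zero G _ 0 (S.condensed 0) s.1 s.2 (congrArg Subtype.val h)
    · intro h
      have : s = 0 := Subtype.ext h
      rw [this, map_zero]
  have h2 : g s = 0 ↔ s.1 = 0 := by
    refine (QuotientAddGroup.eq_zero_iff (sectionsToCocycles (S.F 0) s)).trans ?_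
    rw [AddSubgroup.mem_addSubgroupOf]
    change toCochainZero _ s.1 = 0 ↔ _
    exact map_eq_zero_iff _ (toCochainZero_injective _)
  rw [h1, h2]

theorem degree_succ {G : GradedPoset P} {J : P → ℕ → Set P} (S : CondensedSequence G J) (n : ℕ) :
    Nonempty ((↥(obDiff G S.F S.pi (n + 1)).ker ⧸
          ((obDiff G S.F S.pi n).range.addSubgroupOf (obDiff G S.F S.pi (n + 1)).ker)) ≃+
        cohomologyOf (S.F n) 1) := by
  obtain ⟨e⟩ := cobar_shift G n (lambdaNT G (S.F n) n) (S.pi n)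
      (lambda_app_injective G _ n (S.condensed n)) (S.pi_surj n) (S.pi_ker n) 0 _ rfl
  suffices h : Nonempty ((↥(obDiff G S.F S.pi (n + 1)).ker ⧸
          ((obDiff G S.F S.pi n).range.addSubgroupOf (obDiff G S.F S.pi (n + 1)).ker)) ≃+
        (↥(cobarDiff (S.F (n + 1)) 0).ker ⧸ ((cobarDiff (kerPrime G (S.F n) n) 0).ker.map
          (homCochain (S.pi n) 0)).addSubgroupOf (cobarDiff (S.F (n + 1)) 0).ker)) by
    obtain ⟨e'⟩ := h
    exact ⟨e'.trans e⟩
  refine nonempty_equiv_of_surj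
    ((QuotientAddGroup.mk' _).comp (sectionsToKer S (n + 1)))
    ((QuotientAddGroup.mk' _).comp (sectionsToCocycles (S.F (n + 1))))
    ((QuotientAddGroup.mk'_surjective _).comp (sectionsToKer_surjective S (n + 1)))
    ((QuotientAddGroup.mk'_surjective _).comp (sectionsToCocycles_surjective _)) ?_
  intro s
  refine (QuotientAddGroup.eq_zero_iff (sectionsToKer S (n + 1) s)).trans
    (Iff.trans ?_ (QuotientAddGroup.eq_zero_iff (sectionsToCocycles (S.F (n + 1)) s)).symm)
  rw [AddSubgroup.mem_addSubgroupOf, AddSubgroup.mem_addSubgroupOf]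
  constructor
  · rintro ⟨x, hx⟩
    have h0 : dhat G n (S.pi n) (extendZero (obSet G n) x) - s.1 = 0 := by
      refine section_eq_zero G _ (n + 1) (S.condensed (n + 1)) _
        (sub_mem (dhat_extend_mem G n (S.pi n) x) s.2) ?_
      rw [map_sub]
      exact sub_eq_zero.2 hx
    refine ⟨toCochainZero (kerPrime G (S.F n) n) (fun p q => x ⟨q.1, q.2.2⟩), ?_, ?_⟩
    · refine (toCochainZero_cocycle _ _).2 ?_
      intro p q h
      rfl
    · funext c
      have h1 := congrFun (sub_eq_zero.1 h0) (c.1 (Fin.last 0))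
      rw [dhat_extend] at h1
      exact h1
  · rintro ⟨z, hz, hzs⟩
    obtain ⟨y, rfl⟩ := toCochainZero_surjective _ z
    have hy := (toCochainZero_cocycle _ _).1 hz
    refine ⟨fun q => y q.1 ⟨q.1, le_rfl, q.2⟩, ?_⟩
    funext p
    change dhat G n (S.pi n) (extendZero (obSet G n) _) p.1 = s.1 p.1
    rw [dhat_extend]
    have h1 : (S.pi n).app p.1 (y p.1) = s.1 p.1 :=
      congrFun hzs ⟨fun _ => p.1, fun _ _ _ => le_rfl⟩
    rw [← h1]
    congr 1
    funext q
    exact (congrFun (hy p.1 q.1 q.2.1) ⟨q.1, le_rfl, q.2.2⟩).symm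

/-- **Theorem 4.6.** Let `𝒫` be a graded poset for which there exists an adequate local
covering family, with associated functors `F₀ = c_ℤ, F₁, F₂, …`. Then the sequence
`0 → ∏_{p ∈ Ob₀𝒫} F₀(p) → ∏_{p ∈ Ob₁𝒫} F₁(p) → ∏_{p ∈ Ob₂𝒫} F₂(p) → …`,
with differentials `d_n = ι_{n+1} ∘ ω_{n+1}`, is a co-chain complex whose cohomology is
`H^*(𝒫; ℤ)`. -/
theorem theorem_4_6 {P : Type} [PartialOrder P] (G : GradedPoset P) (J : P → ℕ → Set P)
    (hJ : IsAdequate G J) (S : CondensedSequence G J) :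
    (∀ n : ℕ, (obDiff G S.F S.pi (n + 1)).comp (obDiff G S.F S.pi n) = 0) ∧
    Nonempty (↥(obDiff G S.F S.pi 0).ker ≃+ cohomologyOf (constZ P) 0) ∧
    ∀ n : ℕ, Nonempty
      ((↥(obDiff G S.F S.pi (n + 1)).ker ⧸
          ((obDiff G S.F S.pi n).range.addSubgroupOf (obDiff G S.F S.pi (n + 1)).ker)) ≃+
        cohomologyOf (constZ P) (n + 1)) := by
  refine ⟨fun n => ?_, ?_, fun n => ?_⟩
  · ext1 x
    exact (obDiff_eq_zero_iff S (n + 1) _).2 ⟨_, dhat_extend_mem G n (S.pi n) x, rfl⟩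
  · rw [← S.F_zero]
    exact degree_zero S
  · rw [← S.F_zero]
    obtain ⟨e⟩ := degree_succ S n
    obtain ⟨e'⟩ := iterated_shift S n 0
    have h0 : n + 1 = 0 + n + 1 := by omega
    have e'' : Nonempty (cohomologyOf (S.F n) 1 ≃+ cohomologyOf (S.F 0) (n + 1)) := by
      rw [h0]; exact ⟨e'⟩
    obtain ⟨e''⟩ := e''
    exact ⟨e.trans e''⟩
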